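/- Let p be an odd prime and let k be an integer with 1 ≤ k < p. Then St^{(1,kp)}(Q_{2,0}) = −k·Q_{2,0}^{2}·Q_{2,1}^{p}·(Q_{2,0}^{p} − Q_{2,1}^{p+1})^{k−1}, where the factor k is reduced mod p. -/

import Mathlib

open MvPolynomial Finset

/-- The total Steenrod-Milnor operation `φ : R → R[t₁,t₂]`,
sending `y_k ↦ y_k + y_k^p t₁ + y_k^{p²} t₂`. Here `R = F_p[y₁,y₂]`
and `R[t₁,t₂]` is modelled as `MvPolynomial (Fin 2) R`. -/
noncomputable def phi (p : ℕ) :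
    MvPolynomial (Fin 2) (ZMod p) →ₐ[ZMod p]
      MvPolynomial (Fin 2) (MvPolynomial (Fin 2) (ZMod p)) :=
  aeval (fun k => C (X k) + C (X k ^ p) * X 0 + C (X k ^ (p ^ 2)) * X 1)

/-- The Steenrod-Milnor operation `St^{(i,j)}` : the coefficient of
`t₁^i t₂^j` in `φ f`. -/
noncomputable def St (p i j : ℕ) (f : MvPolynomial (Fin 2) (ZMod p)) :
    MvPolynomial (Fin 2) (ZMod p) :=
  coeff (Finsupp.single (0 : Fin 2) i + Finsupp.single (1 : Fin 2) j) (phi p f)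

/-- `L₂ = y₁ y₂^p - y₁^p y₂`. -/
noncomputable def L2 (p : ℕ) : MvPolynomial (Fin 2) (ZMod p) :=
  X 0 * X 1 ^ p - X 0 ^ p * X 1

/-- `L_{2,0} = y₁^p y₂^{p²} - y₁^{p²} y₂^p`. -/
noncomputable def L20 (p : ℕ) : MvPolynomial (Fin 2) (ZMod p) :=
  X 0 ^ p * X 1 ^ (p ^ 2) - X 0 ^ (p ^ 2) * X 1 ^ p

/-- `L_{2,1} = y₁ y₂^{p²} - y₁^{p²} y₂`. -/
noncomputable def L21 (p : ℕ) : MvPolynomial (Fin 2) (ZMod p) :=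
  X 0 * X 1 ^ (p ^ 2) - X 0 ^ (p ^ 2) * X 1

/-- Coefficient extraction through iterated univariate polynomials. -/
noncomputable def psi (R : Type*) [CommRing R] :
    MvPolynomial (Fin 2) R →+* Polynomial (Polynomial R) :=
  MvPolynomial.eval₂Hom (Polynomial.C.comp Polynomial.C) ![Polynomial.X, Polynomial.C Polynomial.X]

lemma coeff_psi {R : Type*} [CommRing R] (f : MvPolynomial (Fin 2) R) (i j : ℕ) :
    MvPolynomial.coeff (Finsupp.single (0 : Fin 2) i + Finsupp.single (1 : Fin 2) j) f =
      ((psi R f).coeff i).coeff j := by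
  induction f using MvPolynomial.induction_on' with
  | monomial u a =>
    have h1 : psi R (MvPolynomial.monomial u a) =
        Polynomial.monomial (u 0) (Polynomial.monomial (u 1) a) := by
      rw [psi, MvPolynomial.coe_eval₂Hom, MvPolynomial.eval₂_monomial,
        Finsupp.prod_fintype _ _ (by simp), Fin.prod_univ_two]
      simp only [Matrix.cons_val_zero, Matrix.cons_val_one, RingHom.comp_apply]
      rw [← Polynomial.C_mul_X_pow_eq_monomial, ← Polynomial.C_mul_X_pow_eq_monomial,
        Polynomial.C_mul, Polynomial.C_pow]
      ring
    rw [h1, MvPolynomial.coeff_monomial, Polynomial.coeff_monomial]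
    by_cases h0 : u 0 = i
    · rw [if_pos h0, Polynomial.coeff_monomial]
      refine if_congr ?_ rfl rfl
      constructor
      · intro h
        rw [h]
        simp
      · intro h
        ext x
        fin_cases x <;> simp [h0, h]
    · rw [if_neg h0, if_neg]
      · simp
      · intro h
        apply h0
        rw [h]
        simp
  | add a b ha hb => simp [ha, hb]

lemma coeff_one_pow {S : Type*} [CommRing S] (P : Polynomial S) (n : ℕ) :
    (P ^ n).coeff 1 = n * P.coeff 0 ^ (n - 1) * P.coeff 1 := by
  have h : ∀ q : Polynomial S, q.coeff 1 = (Polynomial.derivative q).coeff 0 := by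
    intro q
    simp [Polynomial.coeff_derivative]
  rw [h, h, Polynomial.derivative_pow]
  simp only [Polynomial.coeff_zero_eq_eval_zero]
  simp

lemma coeff_expand_pow {R : Type*} [CommRing R] (p m n : ℕ) (hm : m < p) (U V : Polynomial R) :
    ((Polynomial.X * Polynomial.expand R p V + Polynomial.expand R p U) ^ m).coeff (n * p) =
      (U ^ m).coeff n := by
  have hp : 0 < p := by omega
  rw [add_pow, Polynomial.finsetSum_coeff, Finset.sum_eq_single 0]
  · simp only [pow_zero, one_mul, Nat.sub_zero, Nat.choose_zero_right, Nat.cast_one, mul_one]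
    rw [← map_pow, Polynomial.coeff_expand_mul hp]
  · intro j hj hj0
    have hj' : j < p := by
      have := Finset.mem_range.mp hj
      omega
    have e : (Polynomial.X * Polynomial.expand R p V) ^ j * Polynomial.expand R p U ^ (m - j) *
        ((m.choose j : ℕ) : Polynomial R) =
        Polynomial.expand R p (V ^ j * U ^ (m - j) * ((m.choose j : ℕ) : Polynomial R)) *
          Polynomial.X ^ j := by
      simp only [map_mul, map_pow, map_natCast]
      ring
    rw [e, Polynomial.coeff_mul_X_pow']
    split_ifs with hle
    · rw [Polynomial.coeff_expand hp, if_neg]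
      intro hd
      have h2 : p ∣ j := (Nat.dvd_sub_iff_right hle (Dvd.intro_left n rfl)).mp hd
      exact hj0 (Nat.eq_zero_of_dvd_of_lt h2 hj')
    · rfl
  · simp

lemma coeff_lin_pow {R : Type*} [CommRing R] (a : R) (m n : ℕ) :
    ((1 + Polynomial.C a * Polynomial.X) ^ m).coeff n = (m.choose n : R) * a ^ n := by
  have : (1 + Polynomial.C a * Polynomial.X) ^ m =
      ((1 + Polynomial.X) ^ m : Polynomial R).comp (Polynomial.C a * Polynomial.X) := by
    simp
  rw [this, Polynomial.comp_C_mul_X_coeff, Polynomial.coeff_one_add_X_pow]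

lemma choose_mod (p : ℕ) [Fact p.Prime] (j : ℕ) (hj : j + 1 < p) :
    (((p - 2).choose j : ℕ) : ZMod p) = (-1) ^ j * (j + 1) := by
  induction j with
  | zero => simp
  | succ j ih =>
    have ih := ih (by omega)
    have h := congrArg (Nat.cast : ℕ → ZMod p) (Nat.choose_succ_right_eq (p - 2) j)
    have hs : ((p - 2 - j : ℕ) : ZMod p) = -(j + 2) := by
      have : ((p - 2 - j + (j + 2) : ℕ) : ZMod p) = 0 := by
        rw [show p - 2 - j + (j + 2) = p by omega]
        simp
      push_cast at this
      linear_combination this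
    have hne : ((j + 1 : ℕ) : ZMod p) ≠ 0 := by
      rw [Ne, ZMod.natCast_eq_zero_iff]
      intro hd
      have := Nat.le_of_dvd (by omega) hd
      omega
    push_cast at h hne ⊢
    rw [ih, hs] at h
    apply mul_right_cancel₀ hne
    rw [h]
    ring

lemma L2_ne_zero (p : ℕ) [Fact p.Prime] : L2 p ≠ 0 := by
  intro h
  have h2 := congrArg (MvPolynomial.aeval (R := ZMod p)
    ![(1 : Polynomial (ZMod p)), Polynomial.X]) h
  simp [L2] at h2
  exact FiniteField.X_pow_card_sub_X_ne_zero (ZMod p) (Fact.out : p.Prime).one_lt h2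

/-- The total operation on `L2`, in abstract form. -/
lemma key {S : Type*} [CommRing S] (p : ℕ) [Fact p.Prime] [CharP S p]
    (a b q0 q1 L t1 t2 : S)
    (h01 : a * b ^ p - a ^ p * b = L)
    (h02 : a * b ^ (p ^ 2) - a ^ (p ^ 2) * b = q1 * L)
    (h12 : a ^ p * b ^ (p ^ 2) - a ^ (p ^ 2) * b ^ p = q0 * L)
    (h03 : a * b ^ (p ^ 3) - a ^ (p ^ 3) * b = (q1 ^ (p + 1) - q0 ^ p) * L)
    (h13 : a ^ p * b ^ (p ^ 3) - a ^ (p ^ 3) * b ^ p = q1 ^ p * q0 * L)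
    (h23 : a ^ (p ^ 2) * b ^ (p ^ 3) - a ^ (p ^ 3) * b ^ (p ^ 2) = q0 ^ (p + 1) * L) :
    (a + a ^ p * t1 + a ^ (p ^ 2) * t2) * (b + b ^ p * t1 + b ^ (p ^ 2) * t2) ^ p -
      (a + a ^ p * t1 + a ^ (p ^ 2) * t2) ^ p * (b + b ^ p * t1 + b ^ (p ^ 2) * t2) =
    L * (1 + q1 * t1 ^ p + (q1 ^ (p + 1) - q0 ^ p) * t2 ^ p + q0 * t1 * t1 ^ p
      + q1 ^ p * q0 * t1 * t2 ^ p - q0 * t2 + q0 ^ (p + 1) * t2 * t2 ^ p) := by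
  have fr : ∀ c : S, (c + c ^ p * t1 + c ^ (p ^ 2) * t2) ^ p =
      c ^ p + c ^ (p ^ 2) * t1 ^ p + c ^ (p ^ 3) * t2 ^ p := by
    intro c
    rw [add_pow_char, add_pow_char, mul_pow, mul_pow, ← pow_mul, ← pow_mul, ← pow_succ, ← pow_two]
  rw [fr, fr]
  linear_combination h01 + t1 ^ p * h02 + t2 ^ p * h03 + t1 * t1 ^ p * h12 + t1 * t2 ^ p * h13
    - t2 * h12 + t2 * t2 ^ p * h23

lemma rels (p : ℕ) [Fact p.Prime]
    (Q0 Q1 : MvPolynomial (Fin 2) (ZMod p))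
    (hQ0 : Q0 * L2 p = L20 p) (hQ1 : Q1 * L2 p = L21 p) :
    Q0 = L2 p ^ (p - 1) ∧
    (X 0 * X 1 ^ (p ^ 3) - X 0 ^ (p ^ 3) * X 1 = (Q1 ^ (p + 1) - Q0 ^ p) * L2 p) ∧
    (X 0 ^ p * X 1 ^ (p ^ 3) - X 0 ^ (p ^ 3) * X 1 ^ p = Q1 ^ p * Q0 * L2 p) ∧
    (X 0 ^ (p ^ 2) * X 1 ^ (p ^ 3) - X 0 ^ (p ^ 3) * X 1 ^ (p ^ 2) = Q0 ^ (p + 1) * L2 p) := by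
  have hL := L2_ne_zero p
  have hp : p.Prime := Fact.out
  have e1 : p ^ 2 * p = p ^ 3 := by ring
  have e2 : p * p = p ^ 2 := by ring
  have hLp : L20 p = L2 p ^ p := by
    rw [L2, sub_pow_char, mul_pow, mul_pow, ← pow_mul, ← pow_mul, e2, L20]
  have hQL : Q0 * L2 p = L2 p ^ p := hQ0.trans hLp
  have hQ : Q0 = L2 p ^ (p - 1) := by
    apply mul_right_cancel₀ hL
    rw [hQL, ← pow_succ, Nat.sub_add_cancel hp.one_le]
  have hQne : Q0 ≠ 0 := by
    rw [hQ]
    exact pow_ne_zero _ hL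
  have h13 : (X 0 ^ p * X 1 ^ (p ^ 3) - X 0 ^ (p ^ 3) * X 1 ^ p : MvPolynomial (Fin 2) (ZMod p))
      = Q1 ^ p * Q0 * L2 p := by
    rw [mul_assoc, hQL, ← mul_pow, hQ1, L21, sub_pow_char, mul_pow, mul_pow, ← pow_mul,
      ← pow_mul, e1]
  have h23 : (X 0 ^ (p ^ 2) * X 1 ^ (p ^ 3) - X 0 ^ (p ^ 3) * X 1 ^ (p ^ 2) :
      MvPolynomial (Fin 2) (ZMod p)) = Q0 ^ (p + 1) * L2 p := by
    rw [pow_succ Q0 p, mul_assoc, hQL, ← mul_pow, hQ0, L20, sub_pow_char, mul_pow, mul_pow,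
      ← pow_mul, ← pow_mul, ← pow_mul, ← pow_mul, e1, e2]
  refine ⟨hQ, ?_, h13, h23⟩
  apply mul_right_cancel₀ (mul_ne_zero hQne hL)
  have h01 : L2 p = X 0 * X 1 ^ p - X 0 ^ p * X 1 := rfl
  have h12 : Q0 * L2 p = X 0 ^ p * X 1 ^ (p ^ 2) - X 0 ^ (p ^ 2) * X 1 ^ p := hQ0
  have h02 : Q1 * L2 p = X 0 * X 1 ^ (p ^ 2) - X 0 ^ (p ^ 2) * X 1 := hQ1
  generalize L2 p = L at *
  -- Plücker relation
  have pl : (X 0 * X 1 ^ (p ^ 3) - X 0 ^ (p ^ 3) * X 1 : MvPolynomial (Fin 2) (ZMod p)) * (Q0 * L)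
      = (Q1 * L) * (Q1 ^ p * Q0 * L) - L * (Q0 ^ (p + 1) * L) := by
    rw [← h13, ← h23, h02, h12]
    conv_rhs => rw [h01]
    ring
  rw [pl]
  ring

theorem st_1kp_Q20 (p : ℕ) (hp : p.Prime) (hodd : Odd p)
    (Q0 Q1 : MvPolynomial (Fin 2) (ZMod p))
    (hQ0 : Q0 * L2 p = L20 p) (hQ1 : Q1 * L2 p = L21 p)
    (k : ℕ) (hk1 : 1 ≤ k) (hkp : k < p) :
    St p 1 (k * p) Q0 =
      -(C (k : ZMod p) * Q0 ^ 2 * Q1 ^ p * (Q0 ^ p - Q1 ^ (p + 1)) ^ (k - 1)) := by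
  have : Fact p.Prime := ⟨hp⟩
  have hp3 : 3 ≤ p := by
    have := hp.two_le
    rcases hodd with ⟨r, hr⟩
    omega
  obtain ⟨hQ, h03, h13, h23⟩ := rels p Q0 Q1 hQ0 hQ1
  have hphiL : phi p (L2 p) = C (L2 p) * (1 + C Q1 * X 0 ^ p
      + (C Q1 ^ (p + 1) - C Q0 ^ p) * X 1 ^ p + C Q0 * X 0 * X 0 ^ p
      + C Q1 ^ p * C Q0 * X 0 * X 1 ^ p - C Q0 * X 1 + C Q0 ^ (p + 1) * X 1 * X 1 ^ p) := by
    rw [← key p (C (X 0)) (C (X 1)) (C Q0) (C Q1) (C (L2 p)) (X 0) (X 1)]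
    · simp [phi, L2]
    · simp [L2]
    · rw [← C_mul, hQ1]; simp [L21]
    · rw [← C_mul, hQ0]; simp [L20]
    · simpa using congrArg (C (σ := Fin 2)) h03
    · simpa using congrArg (C (σ := Fin 2)) h13
    · simpa using congrArg (C (σ := Fin 2)) h23
  have hphi : phi p Q0 = C Q0 * (1 + C Q1 * X 0 ^ p
      + (C Q1 ^ (p + 1) - C Q0 ^ p) * X 1 ^ p + C Q0 * X 0 * X 0 ^ p
      + C Q1 ^ p * C Q0 * X 0 * X 1 ^ p - C Q0 * X 1
      + C Q0 ^ (p + 1) * X 1 * X 1 ^ p) ^ (p - 1) := by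
    conv_lhs => rw [hQ, map_pow, hphiL, mul_pow, ← C_pow, ← hQ]
  rw [St, hphi, MvPolynomial.coeff_C_mul, coeff_psi, map_pow, coeff_one_pow]
  set P := psi _ (1 + C Q1 * X 0 ^ p
      + (C Q1 ^ (p + 1) - C Q0 ^ p) * X 1 ^ p + C Q0 * X 0 * X 0 ^ p
      + C Q1 ^ p * C Q0 * X 0 * X 1 ^ p - C Q0 * X 1
      + C Q0 ^ (p + 1) * X 1 * X 1 ^ p) with hP
  obtain ⟨r, hr⟩ : ∃ r, p = r + 2 := ⟨p - 2, by omega⟩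
  set U : Polynomial (MvPolynomial (Fin 2) (ZMod p)) :=
    1 + Polynomial.C (Q1 ^ (p + 1) - Q0 ^ p) * Polynomial.X with hU
  set V : Polynomial (MvPolynomial (Fin 2) (ZMod p)) :=
    - Polynomial.C Q0 + Polynomial.C (Q0 ^ (p + 1)) * Polynomial.X with hV
  have hPe : P = Polynomial.C (Polynomial.X * Polynomial.expand _ p V + Polynomial.expand _ p U)
      + Polynomial.C (Polynomial.C (Q1 ^ p * Q0) * Polynomial.X ^ p) * Polynomial.X
      + Polynomial.C (Polynomial.C Q1) * Polynomial.X ^ p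
      + Polynomial.C (Polynomial.C Q0) * Polynomial.X ^ (p + 1) := by
    rw [hP, hU, hV]
    simp [psi]
    ring
  have hP0 : P.coeff 0 =
      Polynomial.X * Polynomial.expand _ p V + Polynomial.expand _ p U := by
    rw [hPe]
    simp only [Polynomial.coeff_add, Polynomial.coeff_C_zero, Polynomial.coeff_C_mul,
      Polynomial.coeff_X_pow, Polynomial.coeff_X_zero]
    rw [if_neg (by omega), if_neg (by omega)]
    simp
  have hP1 : P.coeff 1 = Polynomial.C (Q1 ^ p * Q0) * Polynomial.X ^ p := by
    rw [hPe]
    simp only [Polynomial.coeff_add, Polynomial.coeff_C_succ, Polynomial.coeff_C_mul,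
      Polynomial.coeff_X_pow, Polynomial.coeff_X_one]
    rw [if_neg (by omega), if_neg (by omega)]
    simp
  obtain ⟨m, rfl⟩ : ∃ m, k = m + 1 := ⟨k - 1, by omega⟩
  have hc : (((p - 1 : ℕ) : MvPolynomial (Fin 2) (ZMod p))) = -1 := by
    rw [Nat.cast_sub hp.one_le]
    simp
  have hch : (((p - 2).choose m : ℕ) : MvPolynomial (Fin 2) (ZMod p)) =
      (-1) ^ m * C ((m + 1 : ℕ) : ZMod p) := by
    have := congrArg (C (σ := Fin 2)) (choose_mod p m (by omega))
    simpa using this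
  have hcalc : (((p - 1 : ℕ) : Polynomial (MvPolynomial (Fin 2) (ZMod p))) *
      P.coeff 0 ^ (p - 1 - 1) * P.coeff 1).coeff ((m + 1) * p) =
      -1 * ((((p - 2).choose m : ℕ) : MvPolynomial (Fin 2) (ZMod p)) *
        (Q1 ^ (p + 1) - Q0 ^ p) ^ m) * (Q1 ^ p * Q0) := by
    have e : ((p - 1 : ℕ) : Polynomial (MvPolynomial (Fin 2) (ZMod p))) *
        P.coeff 0 ^ (p - 1 - 1) * P.coeff 1 =
        Polynomial.C (((p - 1 : ℕ) : MvPolynomial (Fin 2) (ZMod p)) * (Q1 ^ p * Q0)) *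
        (P.coeff 0 ^ (p - 2) * Polynomial.X ^ p) := by
      rw [hP1, Polynomial.C_mul (a := ((p - 1 : ℕ) : MvPolynomial (Fin 2) (ZMod p))),
        Polynomial.C_eq_natCast, show p - 1 - 1 = p - 2 by omega]
      ring
    rw [e, Polynomial.coeff_C_mul, add_mul, one_mul, Polynomial.coeff_mul_X_pow, hP0,
      coeff_expand_pow p (p - 2) m (by omega), hU, coeff_lin_pow, hc]
    ring
  rw [hcalc, hch, Nat.add_sub_cancel,
    show Q1 ^ (p + 1) - Q0 ^ p = (-1) * (Q0 ^ p - Q1 ^ (p + 1)) by ring, mul_pow]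
  have hs : ((-1 : MvPolynomial (Fin 2) (ZMod p)) ^ m) * (-1) ^ m = 1 := by
    rw [← mul_pow]
    simp
  linear_combination (-(C ((m + 1 : ℕ) : ZMod p) * Q0 ^ 2 * Q1 ^ p *
    (Q0 ^ p - Q1 ^ (p + 1)) ^ m)) * hs
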